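/- For every 2 ≤ k ≤ n and every 1 ≤ i ≤ k−1, the Coxeter length of t_k^i in S_n satisfies ℓ(t_k^i) = k·i − i². -/

import Mathlib

/-!
Setup for the symmetric group `Sₙ`, realized as `Equiv.Perm (Fin n)` with `Fin n`
encoding `{1, …, n}` (0-indexed positions).  The paper multiplies permutations
left-to-right: `(π·σ)(i) = σ(π(i))`, while Mathlib composes right-to-left:
`(π * σ) i = π (σ i)`.  Hence a paper product `a₁ · a₂ ⋯ a_k` is encoded as the
Mathlib product `a_k * ⋯ * a₂ * a₁` (the leftmost paper factor acts first).
-/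

open Equiv Finset

/-- The adjacent transposition `sᵢ` (1-indexed values): the transposition `(i, i+1)`,
as a permutation of `Fin n`; junk value `1` outside the range `1 ≤ i ≤ n-1`. -/
def sP (n : ℕ) (i : ℕ) : Equiv.Perm (Fin n) :=
  if h : i < n then Equiv.swap ⟨i - 1, by omega⟩ ⟨i, h⟩ else 1

/-- `tₘ = s₁·s₂⋯s_{m−1}` (left-to-right), i.e. the `m`-cycle sending `1 ↦ m` and
`j ↦ j−1` for `2 ≤ j ≤ m` (1-indexed), fixing every `j > m`; `t₁ = 1`. -/
def tP (n : ℕ) (m : ℕ) : Equiv.Perm (Fin n) :=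
  if h : m - 1 < n then ((⟨m - 1, h⟩ : Fin n).cycleRange)⁻¹ else 1

/-- The paper's left-to-right product `f a · f (a+1) ⋯ f b` (increasing indices,
so `f a` acts first), encoded in Mathlib's composition order. -/
def ogsProd {n : ℕ} (a b : ℕ) (f : ℕ → Equiv.Perm (Fin n)) : Equiv.Perm (Fin n) :=
  ((List.range' a (b + 1 - a)).map f).reverse.prod

/-- The paper's left-to-right product `f b · f (b−1) ⋯ f a` (decreasing indices,
so `f b` acts first), encoded in Mathlib's composition order. -/
def ogsProdDesc {n : ℕ} (a b : ℕ) (f : ℕ → Equiv.Perm (Fin n)) : Equiv.Perm (Fin n) :=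
  ((List.range' a (b + 1 - a)).map f).prod

/-- The Coxeter length of `π`: the number of inversions, i.e. of pairs `i < j`
with `π(i) > π(j)`. -/
def len {n : ℕ} (π : Equiv.Perm (Fin n)) : ℕ :=
  (Finset.univ.filter fun p : Fin n × Fin n => p.1 < p.2 ∧ π p.2 < π p.1).card

/-- The descent set of `π`: the set of 1-indexed positions `i ∈ {1, …, n−1}`
with `π(i) > π(i+1)`. -/
def descents {n : ℕ} (π : Equiv.Perm (Fin n)) : Finset ℕ :=
  (Finset.Ico 1 n).filter fun i => ∃ h : i < n, π ⟨i, h⟩ < π ⟨i - 1, by omega⟩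

lemma tP_apply_val {n k : ℕ} (hk : 1 ≤ k) (hkn : k ≤ n) (j : Fin n) :
    (tP n k j : ℕ) = if (j : ℕ) = 0 then k - 1 else if (j : ℕ) < k then j - 1 else j := by
  have h : k - 1 < n := by omega
  obtain ⟨m, rfl⟩ := (⟨k - 1, h⟩ : Fin n).cycleRange.surjective j
  simp only [tP, dif_pos h, Perm.inv_def, symm_apply_apply]
  rcases lt_trichotomy (m : ℕ) (k - 1) with hm | hm | hm
  · have := Fin.coe_cycleRange_of_lt (i := m) (j := ⟨k - 1, h⟩) hm
    split_ifs <;> omega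
  · obtain rfl : m = ⟨k - 1, h⟩ := Fin.ext hm
    have : NeZero n := ⟨by omega⟩
    simp [Fin.cycleRange_self]
  · rw [Fin.cycleRange_of_gt (j := m) (i := ⟨k - 1, h⟩) hm]
    split_ifs <;> omega

lemma tP_pow_apply_val {n k i : ℕ} (hk : 1 ≤ k) (hkn : k ≤ n) (hik : i ≤ k) (j : Fin n) :
    ((tP n k ^ i) j : ℕ) =
      if (j : ℕ) < i then j + (k - i) else if (j : ℕ) < k then j - i else j := by
  induction i with
  | zero => simp
  | succ i ih =>
    rw [pow_succ', Perm.mul_apply, tP_apply_val hk hkn, ih (by omega)]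
    split_ifs <;> omega

/-- For `2 ≤ k ≤ n` and `1 ≤ i ≤ k−1`, the Coxeter length of
`t_k^i` in `Sₙ` is `k·i − i²`. -/
theorem length_of_t_pow (n k i : ℕ) (hk : 2 ≤ k) (hkn : k ≤ n)
    (hi : 1 ≤ i) (hik : i ≤ k - 1) :
    len (tP n k ^ i) = k * i - i ^ 2 := by
  have inversion_iff (a b : Fin n) :
      (a < b ∧ (tP n k ^ i) b < (tP n k ^ i) a) ↔ (a : ℕ) < i ∧ i ≤ (b : ℕ) ∧ (b : ℕ) < k := by
    rw [Fin.lt_def, Fin.lt_def, tP_pow_apply_val (by omega) hkn (by omega),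
      tP_pow_apply_val (by omega) hkn (by omega)]
    split_ifs <;> omega
  have card_eq : len (tP n k ^ i) = (range i ×ˢ Ico i k).card := by
    simp only [len, inversion_iff]
    refine card_bij (fun p _ => (p.1.val, p.2.val)) ?_ ?_ ?_
    · simp
    · simp +contextual [Prod.ext_iff, Fin.ext_iff]
    · rintro ⟨a, b⟩ h
      simp only [mem_product, mem_range, mem_Ico] at h
      exact ⟨(⟨a, by omega⟩, ⟨b, by omega⟩), by simpa using h, rfl⟩
  rw [card_eq, card_product, card_range, Nat.card_Ico, Nat.mul_sub, sq, mul_comm i k]
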